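/- A function u : [0,T]×Ω → ℝ is a minimax L-supersolution of (TVP) if and only if u is lower semicontinuous with respect to d_∞, u(T,·) ≥ h on Ω, and for each (s_0,x_0,z) ∈ [0,T)×Ω×ℝ^d, each y_0 ≥ u(s_0,x_0), and each t ∈ (s_0,T], there exists (x,y) ∈ Y^L(s_0,x_0,y_0,z) such that y(t) ≥ u(t,x). -/

import Mathlib

open MeasureTheory Set Filter Topology
open scoped InnerProductSpace

noncomputable section

namespace PHJ

/-- The Euclidean state space `ℝ^d`. -/
abbrev E (d : ℕ) := EuclideanSpace ℝ (Fin d)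

/-- A path; only its values on `[0, T]` are relevant. -/
abbrev Path (d : ℕ) := ℝ → E d

/-- The set `Ω = D([0,T], ℝ^d)` of paths that are right-continuous on `[0,T)` and have
left limits on `(0,T]`. -/
def Cadlag (T : ℝ) (d : ℕ) : Set (Path d) :=
  {x | (∀ t ∈ Ico (0 : ℝ) T, ContinuousWithinAt x (Ici t) t) ∧
       (∀ t ∈ Ioc (0 : ℝ) T, ∃ l : E d, Tendsto x (nhdsWithin t (Iio t)) (nhds l))}

/-- The running supremum `sup_{0 ≤ s ≤ t} |x(s)|`. -/
def runSup (d : ℕ) (x : Path d) (t : ℝ) : ℝ :=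
  sSup ((fun s => ‖x s‖) '' Icc 0 t)

/-- The supremum distance `sup_{0 ≤ s ≤ T} |x(s) − y(s)|`. -/
def supDist (T : ℝ) (d : ℕ) (x y : Path d) : ℝ :=
  sSup ((fun s => ‖x s - y s‖) '' Icc 0 T)

/-- The stopped supremum distance `sup_{0 ≤ r ≤ T} |x(r ∧ t) − y(r ∧ s)|`. -/
def stopDist (T : ℝ) (d : ℕ) (t : ℝ) (x : Path d) (s : ℝ) (y : Path d) : ℝ :=
  sSup ((fun r => ‖x (min r t) - y (min r s)‖) '' Icc 0 T)

/-- The pseudometric `d_∞` on `[0,T] × Ω`. -/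
def dInf (T : ℝ) (d : ℕ) (p q : ℝ × Path d) : ℝ :=
  |p.1 - q.1| + stopDist T d p.1 p.2 q.1 q.2

/-- `g` is an integrable a.e.-derivative of `x` on `[s₀, T]` (so that `x` is absolutely
continuous there) satisfying the growth bound `|x′(t)| ≤ L (1 + sup_{s ≤ t} |x(s)|)` a.e. -/
def XDeriv (T : ℝ) (d : ℕ) (L s₀ : ℝ) (x g : Path d) : Prop :=
  IntegrableOn g (Icc s₀ T) volume ∧
  (∀ t ∈ Icc s₀ T, x t = x s₀ + ∫ s in s₀..t, g s) ∧
  (∀ᵐ t ∂(volume.restrict (Ioo s₀ T)), ‖g t‖ ≤ L * (1 + runSup d x t))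

/-- The set `X^L(s₀, x₀)` of "Lipschitz-like" paths. -/
def XSet (T : ℝ) (d : ℕ) (L s₀ : ℝ) (x₀ : Path d) : Set (Path d) :=
  {x | x ∈ Cadlag T d ∧ (∀ t ∈ Icc 0 s₀, x t = x₀ t) ∧ ∃ g, XDeriv T d L s₀ x g}

/-- Type of Hamiltonians `H(t, x, y, z)`. -/
abbrev Ham (d : ℕ) := ℝ → Path d → ℝ → E d → ℝ

/-- The set `Y^L(s₀, x₀, y₀, z)` of characteristic pairs `(x, y)`. -/
def YSet (T : ℝ) (d : ℕ) (H : Ham d) (L s₀ : ℝ) (x₀ : Path d) (y₀ : ℝ) (z : E d) :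
    Set (Path d × (ℝ → ℝ)) :=
  {p | p.1 ∈ Cadlag T d ∧ (∀ t ∈ Icc 0 s₀, p.1 t = x₀ t) ∧
       ContinuousOn p.2 (Icc s₀ T) ∧
       ∃ g, XDeriv T d L s₀ p.1 g ∧
         IntegrableOn (fun s => ⟪g s, z⟫_ℝ - H s p.1 (p.2 s) z) (Icc s₀ T) volume ∧
         ∀ t ∈ Icc s₀ T, p.2 t = y₀ + ∫ s in s₀..t, (⟪g s, z⟫_ℝ - H s p.1 (p.2 s) z)}

/-- Assumption (i): for a.e. `t`, `(x, y, z) ↦ H(t, x, y, z)` is continuous. -/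
def HamCont (T : ℝ) (d : ℕ) (H : Ham d) : Prop :=
  ∀ᵐ t ∂(volume.restrict (Ioo (0 : ℝ) T)),
    ∀ x ∈ Cadlag T d, ∀ (y : ℝ) (z : E d), ∀ ε > (0 : ℝ), ∃ δ > (0 : ℝ),
      ∀ x' ∈ Cadlag T d, ∀ (y' : ℝ) (z' : E d),
        supDist T d x x' < δ → |y - y'| < δ → ‖z - z'‖ < δ →
        |H t x y z - H t x' y' z'| < ε

/-- Assumption (ii): `t ↦ H(t, x, y, z)` is Borel measurable. -/
def HamMeas (d : ℕ) (H : Ham d) : Prop :=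
  ∀ (x : Path d) (y : ℝ) (z : E d), Measurable fun t => H t x y z

/-- Assumption (iii): Lipschitz continuity in `z` with constant `L_H (1 + sup_{s≤t} |x(s)|)`. -/
def HamLipZ (T : ℝ) (d : ℕ) (H : Ham d) (LH : ℝ) : Prop :=
  0 ≤ LH ∧ ∀ᵐ t ∂(volume.restrict (Ioo (0 : ℝ) T)),
    ∀ x ∈ Cadlag T d, ∀ (y : ℝ) (z z' : E d),
      |H t x y z - H t x y z'| ≤ LH * (1 + runSup d x t) * ‖z - z'‖

/-- Assumption (iv): local Lipschitz continuity in `x` along `X^L`-paths,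
with constant `M L`. -/
def HamLipX (T : ℝ) (d : ℕ) (H : Ham d) (M : ℝ → ℝ) : Prop :=
  ∀ L ≥ (0 : ℝ), 0 ≤ M L ∧
    ∀ t₀ ∈ Ico (0 : ℝ) T, ∀ x₀ ∈ Cadlag T d,
      ∀ x ∈ XSet T d L t₀ x₀, ∀ x' ∈ XSet T d L t₀ x₀, ∀ (y : ℝ) (z : E d),
        ∀ᵐ t ∂(volume.restrict (Ioo t₀ T)),
          |H t x y z - H t x' y z| ≤
            M L * (1 + |y| + ‖z‖) * sSup ((fun s => ‖x s - x' s‖) '' Icc 0 t)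

/-- Assumption (v): `y ↦ H(t, x, y, z)` is non-increasing. -/
def HamMono (T : ℝ) (d : ℕ) (H : Ham d) : Prop :=
  ∀ᵐ t ∂(volume.restrict (Ioo (0 : ℝ) T)),
    ∀ x ∈ Cadlag T d, ∀ (z : E d) (y y' : ℝ), y ≤ y' → H t x y' z ≤ H t x y z

/-- Assumption (vi): growth bound `|H(t, x, y, 0)| ≤ C_H (1 + sup_{s≤t}|x(s)| + |y|)`. -/
def HamBound (T : ℝ) (d : ℕ) (H : Ham d) (CH : ℝ) : Prop :=
  0 ≤ CH ∧ ∀ᵐ t ∂(volume.restrict (Ioo (0 : ℝ) T)),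
    ∀ x ∈ Cadlag T d, ∀ y : ℝ, |H t x y 0| ≤ CH * (1 + runSup d x t + |y|)

/-- Lower semicontinuity on `[0,T] × Ω` with respect to `d_∞`. -/
def LscOn (T : ℝ) (d : ℕ) (u : ℝ → Path d → ℝ) : Prop :=
  ∀ t₀ ∈ Icc (0 : ℝ) T, ∀ x₀ ∈ Cadlag T d, ∀ c : ℝ, c < u t₀ x₀ →
    ∃ δ > (0 : ℝ), ∀ t ∈ Icc (0 : ℝ) T, ∀ x ∈ Cadlag T d,
      dInf T d (t₀, x₀) (t, x) < δ → c < u t x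

/-- Upper semicontinuity on `[0,T] × Ω` with respect to `d_∞`. -/
def UscOn (T : ℝ) (d : ℕ) (u : ℝ → Path d → ℝ) : Prop :=
  ∀ t₀ ∈ Icc (0 : ℝ) T, ∀ x₀ ∈ Cadlag T d, ∀ c : ℝ, u t₀ x₀ < c →
    ∃ δ > (0 : ℝ), ∀ t ∈ Icc (0 : ℝ) T, ∀ x ∈ Cadlag T d,
      dInf T d (t₀, x₀) (t, x) < δ → u t x < c

/-- Continuity of the terminal condition `h` with respect to the sup norm. -/
def TermCont (T : ℝ) (d : ℕ) (h : Path d → ℝ) : Prop :=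
  ∀ x ∈ Cadlag T d, ∀ ε > (0 : ℝ), ∃ δ > (0 : ℝ), ∀ x' ∈ Cadlag T d,
    supDist T d x x' < δ → |h x' - h x| < ε

/-- `u` is a minimax `L`-supersolution of the terminal-value problem (TVP). -/
def MinimaxSuper (T : ℝ) (d : ℕ) (H : Ham d) (h : Path d → ℝ) (L : ℝ)
    (u : ℝ → Path d → ℝ) : Prop :=
  LscOn T d u ∧ (∀ x ∈ Cadlag T d, h x ≤ u T x) ∧
  ∀ s₀ ∈ Ico (0 : ℝ) T, ∀ x₀ ∈ Cadlag T d, ∀ (z : E d) (y₀ : ℝ), u s₀ x₀ ≤ y₀ →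
    ∃ p ∈ YSet T d H L s₀ x₀ y₀ z, ∀ t ∈ Icc s₀ T, u t p.1 ≤ p.2 t

/-- `u` is a minimax `L`-subsolution of the terminal-value problem (TVP). -/
def MinimaxSub (T : ℝ) (d : ℕ) (H : Ham d) (h : Path d → ℝ) (L : ℝ)
    (u : ℝ → Path d → ℝ) : Prop :=
  UscOn T d u ∧ (∀ x ∈ Cadlag T d, u T x ≤ h x) ∧
  ∀ s₀ ∈ Ico (0 : ℝ) T, ∀ x₀ ∈ Cadlag T d, ∀ (z : E d) (y₀ : ℝ), y₀ ≤ u s₀ x₀ →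
    ∃ p ∈ YSet T d H L s₀ x₀ y₀ z, ∀ t ∈ Icc s₀ T, p.2 t ≤ u t p.1

/-- `u` is a minimax `L`-solution of the terminal-value problem (TVP). -/
def MinimaxSol (T : ℝ) (d : ℕ) (H : Ham d) (h : Path d → ℝ) (L : ℝ)
    (u : ℝ → Path d → ℝ) : Prop :=
  MinimaxSuper T d H h L u ∧ MinimaxSub T d H h L u

/-- Embedding of a path into the space of functions on `[0,T]` with the topology of
uniform convergence (i.e. the sup-norm topology). -/
def toUnif (T : ℝ) (d : ℕ) (x : Path d) : UniformFun (Icc (0 : ℝ) T) (E d) :=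
  UniformFun.ofFun fun s => x s.1

/-- Embedding of a real-valued function into the space of functions on `[s₀,T]` with the
topology of uniform convergence. -/
def toUnifR (T s₀ : ℝ) (y : ℝ → ℝ) : UniformFun (Icc s₀ T) ℝ :=
  UniformFun.ofFun fun s => y s.1


/-- Continuity on `[0,T] × Ω` with respect to `d_∞`. -/
def Cont2 (T : ℝ) (d : ℕ) (u : ℝ → Path d → ℝ) : Prop :=
  ∀ t₀ ∈ Icc (0 : ℝ) T, ∀ x₀ ∈ Cadlag T d, ∀ ε > (0 : ℝ), ∃ δ > (0 : ℝ),
    ∀ t ∈ Icc (0 : ℝ) T, ∀ x ∈ Cadlag T d,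
      dInf T d (t₀, x₀) (t, x) < δ → |u t x - u t₀ x₀| < ε

section Auxiliary

variable {T : ℝ} {d : ℕ}

theorem Cadlag.isBounded_image {x : Path d} (hx : x ∈ Cadlag T d) :
    Bornology.IsBounded (x '' Icc 0 T) := by
  refine isCompact_Icc.induction_on (p := fun s => Bornology.IsBounded (x '' s)) (by simp)
    (fun s t hst ht => ht.subset (image_mono hst))
    (fun s t hs ht => by rw [image_union]; exact hs.union ht) fun t ht => ?_
  have bdd_of_tendsto : ∀ (l : Filter ℝ) (c : E d), Tendsto x l (𝓝 c) →
      ∃ s ∈ l, Bornology.IsBounded (x '' s) := fun l c hc =>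
    ⟨x ⁻¹' Metric.ball c 1, hc (Metric.ball_mem_nhds c one_pos),
      Metric.isBounded_ball.subset (image_preimage_subset _ _)⟩
  obtain ⟨u, hu, hub⟩ : ∃ s ∈ 𝓝[Icc 0 T ∩ Iio t] t, Bornology.IsBounded (x '' s) := by
    rcases ht.1.eq_or_lt with rfl | h0
    · refine ⟨∅, ?_, by simp⟩
      have : Icc 0 T ∩ Iio (0 : ℝ) = ∅ := by
        ext s; simp only [mem_inter_iff, mem_Icc, mem_Iio, mem_empty_iff_false]; grind
      simp [this]
    · obtain ⟨l, hl⟩ := hx.2 t ⟨h0, ht.2⟩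
      exact bdd_of_tendsto _ l (hl.mono_left (nhdsWithin_mono _ inter_subset_right))
  obtain ⟨v, hv, hvb⟩ : ∃ s ∈ 𝓝[Icc 0 T ∩ Ici t] t, Bornology.IsBounded (x '' s) := by
    rcases ht.2.eq_or_lt with rfl | hT
    · refine ⟨{t}, ?_, by simp⟩
      have : Icc 0 t ∩ Ici t = {t} := by
        ext s; simp only [mem_inter_iff, mem_Icc, mem_Ici, mem_singleton_iff]; grind
      simp [this]
    · exact bdd_of_tendsto _ _ ((hx.1 t ⟨ht.1, hT⟩).mono_left
        (nhdsWithin_mono _ inter_subset_right))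
  refine ⟨u ∪ v, ?_, by rw [image_union]; exact hub.union hvb⟩
  have : Icc 0 T = Icc 0 T ∩ Iio t ∪ Icc 0 T ∩ Ici t := by
    rw [← inter_union_distrib_left, Iio_union_Ici, inter_univ]
  rw [this, nhdsWithin_union]
  exact union_mem_sup hu hv

theorem Cadlag.bddAbove_norm {x : Path d} (hx : x ∈ Cadlag T d) {t : ℝ} (ht : t ≤ T) :
    BddAbove ((fun s => ‖x s‖) '' Icc 0 t) := by
  obtain ⟨C, hC⟩ := (Cadlag.isBounded_image hx).exists_norm_le
  refine ⟨C, ?_⟩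
  rintro _ ⟨s, hs, rfl⟩
  exact hC _ (mem_image_of_mem _ ⟨hs.1, hs.2.trans ht⟩)

theorem norm_le_runSup {x : Path d} (hx : x ∈ Cadlag T d) {s t : ℝ} (hs : s ∈ Icc 0 t)
    (ht : t ≤ T) : ‖x s‖ ≤ runSup d x t :=
  le_csSup (Cadlag.bddAbove_norm hx ht) (mem_image_of_mem _ hs)

theorem runSup_le {x : Path d} {t c : ℝ} (ht : 0 ≤ t) (h : ∀ s ∈ Icc 0 t, ‖x s‖ ≤ c) :
    runSup d x t ≤ c := by
  refine csSup_le ((nonempty_Icc.2 ht).image _) ?_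
  rintro _ ⟨s, hs, rfl⟩
  exact h s hs

theorem runSup_nonneg (x : Path d) (t : ℝ) : 0 ≤ runSup d x t := by
  refine Real.sSup_nonneg ?_
  rintro _ ⟨s, -, rfl⟩
  exact norm_nonneg _

theorem runSup_mono {x : Path d} (hx : x ∈ Cadlag T d) {s t : ℝ} (hs : 0 ≤ s) (hst : s ≤ t)
    (ht : t ≤ T) : runSup d x s ≤ runSup d x t :=
  runSup_le hs fun _ hr => norm_le_runSup hx ⟨hr.1, hr.2.trans hst⟩ ht

theorem runSup_congr {x x' : Path d} {t : ℝ} (h : ∀ s ∈ Icc 0 t, x s = x' s) :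
    runSup d x t = runSup d x' t := by
  unfold runSup
  congr 1
  exact image_congr fun s hs => by rw [h s hs]

/-- Increments of `x` on `[s₀, T]` are controlled by the running supremum. -/
def IncBound (T : ℝ) (d : ℕ) (L s₀ : ℝ) (x : Path d) : Prop :=
  ∀ a b, s₀ ≤ a → a ≤ b → b ≤ T → ‖x b - x a‖ ≤ L * (1 + runSup d x b) * (b - a)

theorem XDeriv.intervalIntegrable {L s₀ : ℝ} {x g : Path d} (h : XDeriv T d L s₀ x g)
    {a b : ℝ} (ha : s₀ ≤ a) (hab : a ≤ b) (hb : b ≤ T) : IntervalIntegrable g volume a b :=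
  (intervalIntegrable_iff_integrableOn_Icc_of_le hab).2 (h.1.mono_set (Icc_subset_Icc ha hb))

theorem XDeriv.sub_eq_integral {L s₀ : ℝ} {x g : Path d} (h : XDeriv T d L s₀ x g)
    {a b : ℝ} (ha : s₀ ≤ a) (hab : a ≤ b) (hb : b ≤ T) : x b - x a = ∫ s in a..b, g s := by
  rw [h.2.1 b ⟨ha.trans hab, hb⟩, h.2.1 a ⟨ha, hab.trans hb⟩, add_sub_add_left_eq_sub,
    intervalIntegral.integral_interval_sub_left
      (h.intervalIntegrable le_rfl (ha.trans hab) hb)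
      (h.intervalIntegrable le_rfl ha (hab.trans hb))]

/-- Almost everywhere on `Ioo s T` implies almost everywhere on any `Ioc` inside `[s, T]`. -/
theorem ae_restrict_Ioc_of_Ioo {s a b : ℝ} (ha : s ≤ a) (hb : b ≤ T) {p : ℝ → Prop}
    (h : ∀ᵐ t ∂(volume.restrict (Ioo s T)), p t) : ∀ᵐ t ∂(volume.restrict (Ioc a b)), p t := by
  rw [restrict_Ioo_eq_restrict_Ioc] at h
  exact ae_restrict_of_ae_restrict_of_subset (Ioc_subset_Ioc ha hb) h

theorem XDeriv.incBound {L s₀ : ℝ} {x g : Path d} (hL : 0 ≤ L) (hs₀ : 0 ≤ s₀)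
    (hx : x ∈ Cadlag T d) (h : XDeriv T d L s₀ x g) : IncBound T d L s₀ x := by
  intro a b ha hab hb
  rw [h.sub_eq_integral ha hab hb]
  have := intervalIntegral.norm_integral_le_of_norm_le_const_ae (a := a) (b := b) (f := g)
    (C := L * (1 + runSup d x b)) ?_
  · rwa [abs_of_nonneg (sub_nonneg.2 hab)] at this
  · rw [uIoc_of_le hab, ← ae_restrict_iff' measurableSet_Ioc]
    filter_upwards [ae_restrict_Ioc_of_Ioo ha hb h.2.2, ae_restrict_mem measurableSet_Ioc]
      with t ht htm
    refine ht.trans (mul_le_mul_of_nonneg_left ?_ hL)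
    gcongr
    exact runSup_mono hx (by linarith [htm.1]) htm.2 hb

theorem lipschitzOnWith_of_le {V : Type*} [SeminormedAddCommGroup V] {f : ℝ → V} {s : Set ℝ}
    {K : ℝ} (hK : 0 ≤ K) (h : ∀ a ∈ s, ∀ b ∈ s, a ≤ b → ‖f b - f a‖ ≤ K * (b - a)) :
    LipschitzOnWith K.toNNReal f s := by
  refine LipschitzOnWith.of_dist_le_mul fun a ha b hb => ?_
  rw [Real.coe_toNNReal _ hK, dist_eq_norm, Real.dist_eq]
  rcases le_total a b with hab | hab
  · rw [norm_sub_rev, abs_sub_comm, abs_of_nonneg (sub_nonneg.2 hab)]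
    exact h a ha b hb hab
  · rw [abs_of_nonneg (sub_nonneg.2 hab)]
    exact h b hb a ha hab

theorem IncBound.lipschitzOnWith {L s₀ : ℝ} {x : Path d} (hL : 0 ≤ L) (hs₀ : 0 ≤ s₀)
    (hx : x ∈ Cadlag T d) (h : IncBound T d L s₀ x) :
    LipschitzOnWith (Real.toNNReal (L * (1 + runSup d x T))) x (Icc s₀ T) := by
  have hR0 := runSup_nonneg x T
  refine lipschitzOnWith_of_le (by positivity) fun a ha b hb hab => ?_
  refine (h a b ha.1 hab hb.2).trans ?_
  have := runSup_mono hx (hs₀.trans hb.1) hb.2 le_rfl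
  have := sub_nonneg.2 hab
  gcongr

theorem IncBound.exists_xDeriv {L s₀ : ℝ} {x : Path d} (hL : 0 ≤ L) (hs₀ : 0 ≤ s₀)
    (hx : x ∈ Cadlag T d) (h : IncBound T d L s₀ x) : ∃ g, XDeriv T d L s₀ x g := by
  rcases lt_or_ge T s₀ with hT | hT
  · exact ⟨0, by simp [IntegrableOn], fun t ht => by grind, by simp [Ioo_eq_empty hT.le.not_gt]⟩
  have hlip := h.lipschitzOnWith hL hs₀ hx
  set K := Real.toNNReal (L * (1 + runSup d x T))
  have hdiff : ∀ᵐ t ∂volume.restrict (Ioo s₀ T), DifferentiableAt ℝ x t := by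
    have h1 := (hlip.mono Ioo_subset_Icc_self).ae_differentiableWithinAt
      (μ := volume) measurableSet_Ioo
    filter_upwards [h1, ae_restrict_mem measurableSet_Ioo] with t ht htm
    exact ht.differentiableAt (isOpen_Ioo.mem_nhds htm)
  have hbound : ∀ᵐ t ∂volume.restrict (Ioo s₀ T), ‖deriv x t‖ ≤ L * (1 + runSup d x t) := by
    filter_upwards [hdiff, ae_restrict_mem measurableSet_Ioo] with t ht htm
    have hd := ht.hasDerivAt.hasDerivWithinAt (s := Iio t)
    rw [hasDerivWithinAt_iff_tendsto_slope' (by simp)] at hd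
    refine le_of_tendsto hd.norm ?_
    filter_upwards [Ioo_mem_nhdsLT htm.1] with a ha
    have := h a t ha.1.le ha.2.le htm.2.le
    have hpos : 0 < t - a := sub_pos.2 ha.2
    rw [slope_comm, slope_def_module, norm_smul, norm_inv, Real.norm_of_nonneg hpos.le,
      inv_mul_le_iff₀ hpos, mul_comm]
    exact this
  have hint : IntegrableOn (deriv x) (Icc s₀ T) volume := by
    rw [integrableOn_Icc_iff_integrableOn_Ioo]
    refine Measure.integrableOn_of_bounded (M := L * (1 + runSup d x T)) (by simp)
      (aestronglyMeasurable_deriv _ _) ?_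
    filter_upwards [hbound, ae_restrict_mem measurableSet_Ioo] with t ht htm
    refine ht.trans (mul_le_mul_of_nonneg_left ?_ hL)
    gcongr
    exact runSup_mono hx (hs₀.trans htm.1.le) htm.2.le le_rfl
  refine ⟨deriv x, hint, fun t ht => ?_, hbound⟩
  have hii : IntervalIntegrable (deriv x) volume s₀ t :=
    (intervalIntegrable_iff_integrableOn_Icc_of_le ht.1).2
      (hint.mono_set (Icc_subset_Icc le_rfl ht.2))
  refine ext_inner_right ℝ fun w => ?_
  have hac : AbsolutelyContinuousOnInterval (fun s => ⟪x s, w⟫_ℝ) s₀ t := by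
    have hl : LipschitzOnWith (K * ‖w‖₊) (fun s => ⟪x s, w⟫_ℝ) (uIcc s₀ t) := by
      refine LipschitzOnWith.of_dist_le_mul fun a ha b hb => ?_
      rw [uIcc_of_le ht.1] at ha hb
      have h1 := hlip.dist_le_mul a ⟨ha.1, ha.2.trans ht.2⟩ b ⟨hb.1, hb.2.trans ht.2⟩
      rw [Real.dist_eq, ← inner_sub_left]
      refine (abs_real_inner_le_norm _ _).trans ?_
      rw [← dist_eq_norm, NNReal.coe_mul, coe_nnnorm, mul_right_comm]
      exact mul_le_mul_of_nonneg_right h1 (norm_nonneg _)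
    exact hl.absolutelyContinuousOnInterval
  have hfun := hac.integral_deriv_eq_sub
  have hcongr : ∫ s in s₀..t, deriv (fun s => ⟪x s, w⟫_ℝ) s = ∫ s in s₀..t, ⟪w, deriv x s⟫_ℝ := by
    refine intervalIntegral.integral_congr_ae_restrict ?_
    rw [uIoc_of_le ht.1]
    filter_upwards [ae_restrict_Ioc_of_Ioo le_rfl ht.2 hdiff] with s hs
    have := (hs.hasDerivAt.inner ℝ (hasDerivAt_const s w)).deriv
    rw [this, inner_zero_right, zero_add, real_inner_comm]
  have hinner : ∫ s in s₀..t, ⟪w, deriv x s⟫_ℝ = ⟪w, ∫ s in s₀..t, deriv x s⟫_ℝ :=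
    (innerSL ℝ w).intervalIntegral_comp_comm hii
  rw [inner_add_left, real_inner_comm w (∫ s in s₀..t, deriv x s)]
  linarith [hfun, hcongr, hinner]

theorem mem_XSet_iff {L s₀ : ℝ} (hL : 0 ≤ L) (hs₀ : 0 ≤ s₀) {x₀ x : Path d} :
    x ∈ XSet T d L s₀ x₀ ↔
      x ∈ Cadlag T d ∧ (∀ t ∈ Icc 0 s₀, x t = x₀ t) ∧ IncBound T d L s₀ x :=
  ⟨fun h => ⟨h.1, h.2.1, h.2.2.choose_spec.incBound hL hs₀ h.1⟩,
    fun h => ⟨h.1, h.2.1, h.2.2.exists_xDeriv hL hs₀ h.1⟩⟩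

/-- **Grönwall's inequality**, integral form. -/
theorem le_mul_exp_of_le_add_integral {f : ℝ → ℝ} {a b A C : ℝ} (hC : 0 ≤ C)
    (hf : ContinuousOn f (Icc a b)) (h : ∀ t ∈ Icc a b, f t ≤ A + C * ∫ s in a..t, f s) :
    ∀ t ∈ Icc a b, f t ≤ A * Real.exp (C * (t - a)) := by
  intro t ht
  have hab : a ≤ b := ht.1.trans ht.2
  have hi : IntervalIntegrable f volume a b := hf.intervalIntegrable_of_Icc hab
  have hF : ∀ s ∈ Icc a b, HasDerivWithinAt (fun s => A + C * ∫ r in a..s, f r) (C * f s)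
      (Icc a b) s := by
    intro s hs
    have : Fact (s ∈ Icc a b) := ⟨hs⟩
    refine HasDerivWithinAt.const_add _ (HasDerivWithinAt.const_mul _ ?_)
    exact intervalIntegral.integral_hasDerivWithinAt_right
      (hi.mono_set (by rw [uIcc_of_le hab, uIcc_of_le hs.1]; exact Icc_subset_Icc le_rfl hs.2))
      (hf.stronglyMeasurableAtFilter_nhdsWithin measurableSet_Icc s) (hf s hs)
  have key := le_gronwallBound_of_liminf_deriv_right_le
    (f := fun s => A + C * ∫ r in a..s, f r) (f' := fun s => C * f s) (δ := A) (K := C) (ε := 0)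
    (a := a) (b := b) (fun s hs => (hF s hs).continuousWithinAt)
    (fun s hs r hr => by
      have h1 := ((hF s (Ico_subset_Icc_self hs)).mono_of_mem_nhdsWithin
        (Icc_mem_nhdsGE_of_mem hs)).Ioi_of_Ici
      have h2 := (hasDerivWithinAt_iff_tendsto_slope' (by simp)).1 h1
      refine (((h2.eventually (gt_mem_nhds hr)).mono fun z hz => ?_)).frequently
      rwa [slope_def_field, div_eq_inv_mul] at hz)
    (by simp)
    (fun s hs => by
      have := mul_le_mul_of_nonneg_left (h s (Ico_subset_Icc_self hs)) hC
      simpa using this) t ht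
  rw [gronwallBound_ε0] at key
  exact (h t ht).trans key

/-- All paths in `X^L(s₀, x₀)` share a common bound. -/
theorem exists_runSup_le {L s₀ : ℝ} (hL : 0 ≤ L) (hs₀ : s₀ ∈ Icc 0 T) (x₀ : Path d) :
    ∃ R, 0 ≤ R ∧ ∀ x ∈ XSet T d L s₀ x₀, runSup d x T ≤ R := by
  set B := runSup d x₀ s₀
  have hB : 0 ≤ B := runSup_nonneg _ _
  refine ⟨(1 + B) * Real.exp (L * (T - s₀)), by positivity, ?_⟩
  rintro x ⟨hx, hxx, g, hg⟩
  have hgi : ∀ t ∈ Icc s₀ T, IntervalIntegrable (fun s => ‖g s‖) volume s₀ t := fun t ht =>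
    (hg.intervalIntegrable le_rfl ht.1 ht.2).norm
  have hψc : ContinuousOn (fun t => 1 + B + ∫ s in s₀..t, ‖g s‖) (Icc s₀ T) := by
    refine continuousOn_const.add ?_
    have := intervalIntegral.continuousOn_primitive_interval (μ := volume)
      (f := fun s => ‖g s‖) (a := s₀) (b := T) (by rw [uIcc_of_le hs₀.2]; exact hg.1.norm)
    rwa [uIcc_of_le hs₀.2] at this
  have hψ : ∀ t ∈ Icc s₀ T, 1 + runSup d x t ≤ 1 + B + ∫ s in s₀..t, ‖g s‖ := by
    intro t ht
    rw [add_assoc]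
    gcongr
    refine runSup_le (hs₀.1.trans ht.1) fun r hr => ?_
    have hs₀B : ∀ r ∈ Icc 0 s₀, ‖x r‖ ≤ B := fun r hr => by
      rw [show B = runSup d x s₀ from runSup_congr fun s hs => (hxx s hs).symm]
      exact norm_le_runSup hx hr hs₀.2
    rcases le_total r s₀ with h | h
    · have : 0 ≤ ∫ s in s₀..t, ‖g s‖ :=
        intervalIntegral.integral_nonneg ht.1 fun _ _ => norm_nonneg _
      linarith [hs₀B r ⟨hr.1, h⟩]
    · rw [hg.2.1 r ⟨h, hr.2.trans ht.2⟩]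
      refine (norm_add_le _ _).trans (add_le_add (hs₀B s₀ ⟨hs₀.1, le_rfl⟩) ?_)
      refine (intervalIntegral.norm_integral_le_integral_norm h).trans ?_
      exact intervalIntegral.integral_mono_interval le_rfl h hr.2
        (Eventually.of_forall fun _ => norm_nonneg _) (hgi t ht)
  have hgron := le_mul_exp_of_le_add_integral (A := 1 + B) hL hψc (fun t ht => by
    gcongr
    rw [← intervalIntegral.integral_const_mul]
    refine intervalIntegral.integral_mono_ae_restrict ht.1 (hgi t ht) ?_ ?_
    · refine ContinuousOn.intervalIntegrable_of_Icc ht.1 ?_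
      exact (continuousOn_const.mul hψc).mono (Icc_subset_Icc le_rfl ht.2)
    · rw [← restrict_Ioc_eq_restrict_Icc]
      filter_upwards [ae_restrict_Ioc_of_Ioo le_rfl ht.2 hg.2.2,
        ae_restrict_mem measurableSet_Ioc] with s hs hsm
      exact hs.trans (mul_le_mul_of_nonneg_left (hψ s ⟨hsm.1.le, hsm.2.trans ht.2⟩) hL))
    T ⟨hs₀.2, le_rfl⟩
  linarith [hψ T ⟨hs₀.2, le_rfl⟩]

theorem supDist_le {x y : Path d} {c : ℝ} (hc : 0 ≤ c) (h : ∀ s ∈ Icc 0 T, ‖x s - y s‖ ≤ c) :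
    supDist T d x y ≤ c := by
  refine Real.sSup_le ?_ hc
  rintro _ ⟨s, hs, rfl⟩
  exact h s hs

theorem HamCont.continuous_y {H : Ham d} (hH1 : HamCont T d H) :
    ∀ᵐ t ∂(volume.restrict (Ioo (0 : ℝ) T)), ∀ x ∈ Cadlag T d, ∀ z : E d,
      Continuous fun y => H t x y z := by
  filter_upwards [hH1] with t ht x hx z
  refine Metric.continuous_iff.2 fun y ε hε => ?_
  obtain ⟨δ, hδ, h⟩ := ht x hx y z ε hε
  refine ⟨δ, hδ, fun y' hy' => ?_⟩
  rw [dist_comm, Real.dist_eq]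
  refine h x hx y' z ((supDist_le le_rfl (by simp)).trans_lt hδ) ?_ (by simpa)
  rwa [← Real.dist_eq, dist_comm]

theorem ae_restrict_Ioo_mono {a b a' b' : ℝ} (ha : a' ≤ a) (hb : b ≤ b') {p : ℝ → Prop}
    (h : ∀ᵐ t ∂(volume.restrict (Ioo a' b')), p t) : ∀ᵐ t ∂(volume.restrict (Ioo a b)), p t :=
  ae_restrict_of_ae_restrict_of_subset (Ioo_subset_Ioo ha hb) h

/-- The Hamiltonian is non-anticipating along paths in `X^L(t₀, x₀)`. -/
theorem ham_congr {H : Ham d} {M : ℝ → ℝ} (hH1 : HamCont T d H) (hH4 : HamLipX T d H M)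
    {L t₀ a : ℝ} (hL : 0 ≤ L) (ht₀ : t₀ ∈ Ico 0 T) (ha : a ≤ T) {x₀ x x' : Path d}
    (hx₀ : x₀ ∈ Cadlag T d) (hx : x ∈ XSet T d L t₀ x₀) (hx' : x' ∈ XSet T d L t₀ x₀)
    (heq : ∀ s ∈ Icc 0 a, x s = x' s) (z : E d) :
    ∀ᵐ t ∂(volume.restrict (Ioo t₀ a)), ∀ y, H t x y z = H t x' y z := by
  have h1 : ∀ᵐ t ∂(volume.restrict (Ioo t₀ T)), ∀ q : ℚ, |H t x q z - H t x' q z| ≤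
      M L * (1 + |(q : ℝ)| + ‖z‖) * sSup ((fun s => ‖x s - x' s‖) '' Icc 0 t) :=
    ae_all_iff.2 fun q => (hH4 L hL).2 t₀ ht₀ x₀ hx₀ x hx x' hx' q z
  filter_upwards [ae_restrict_Ioo_mono le_rfl ha h1, ae_restrict_mem measurableSet_Ioo,
    ae_restrict_Ioo_mono ht₀.1 ha hH1.continuous_y] with t ht htm hc y
  have hrat : ∀ q : ℚ, H t x q z = H t x' q z := by
    intro q
    have h0 : sSup ((fun s => ‖x s - x' s‖) '' Icc 0 t) ≤ 0 := by
      refine Real.sSup_nonpos ?_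
      rintro _ ⟨s, hs, rfl⟩
      simp [heq s ⟨hs.1, hs.2.trans htm.2.le⟩]
    have h2 := (ht q).trans (mul_nonpos_of_nonneg_of_nonpos
      (mul_nonneg (hH4 L hL).1 (by positivity)) h0)
    exact sub_eq_zero.1 (abs_nonpos_iff.1 h2)
  exact congrFun ((hc x hx.1 z).ext_on Rat.denseRange_cast (hc x' hx'.1 z)
    (by rintro _ ⟨q, rfl⟩; exact hrat q)) y

/-- Description of characteristic pairs without reference to the derivative of the path. -/
theorem mem_YSet_iff {H : Ham d} {L s₀ y₀ : ℝ} {x₀ : Path d} {z : E d}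
    {p : Path d × (ℝ → ℝ)} :
    p ∈ YSet T d H L s₀ x₀ y₀ z ↔ p.1 ∈ XSet T d L s₀ x₀ ∧ ContinuousOn p.2 (Icc s₀ T) ∧
      IntegrableOn (fun s => H s p.1 (p.2 s) z) (Icc s₀ T) volume ∧
      ∀ t ∈ Icc s₀ T, p.2 t =
        y₀ + ⟪p.1 t - p.1 s₀, z⟫_ℝ - ∫ s in s₀..t, H s p.1 (p.2 s) z := by
  have hgz : ∀ g, XDeriv T d L s₀ p.1 g → IntegrableOn (fun s => ⟪g s, z⟫_ℝ) (Icc s₀ T) volume :=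
    fun g hg => hg.1.inner_const z
  have hgt : ∀ g, XDeriv T d L s₀ p.1 g → ∀ t ∈ Icc s₀ T,
      ∫ s in s₀..t, ⟪g s, z⟫_ℝ = ⟪p.1 t - p.1 s₀, z⟫_ℝ := by
    intro g hg t ht
    rw [hg.sub_eq_integral le_rfl ht.1 ht.2, real_inner_comm]
    have := (innerSL ℝ z).intervalIntegral_comp_comm (hg.intervalIntegrable le_rfl ht.1 ht.2)
    simpa [real_inner_comm] using this
  have hii : ∀ {f : ℝ → ℝ}, IntegrableOn f (Icc s₀ T) volume → ∀ t ∈ Icc s₀ T,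
      IntervalIntegrable f volume s₀ t := fun hf t ht =>
    (intervalIntegrable_iff_integrableOn_Icc_of_le ht.1).2
      (hf.mono_set (Icc_subset_Icc le_rfl ht.2))
  constructor
  · rintro ⟨h1, h2, h3, g, hg, hint, hy⟩
    have hH : IntegrableOn (fun s => H s p.1 (p.2 s) z) (Icc s₀ T) volume := by
      refine ((hgz g hg).sub hint).congr (Eventually.of_forall fun s => ?_)
      simp
    refine ⟨⟨h1, h2, g, hg⟩, h3, hH, fun t ht => ?_⟩
    rw [hy t ht, intervalIntegral.integral_sub (hii (hgz g hg) t ht) (hii hH t ht), hgt g hg t ht,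
      add_sub_assoc]
  · rintro ⟨⟨h1, h2, g, hg⟩, h3, hH, hy⟩
    refine ⟨h1, h2, h3, g, hg, (hgz g hg).sub hH, fun t ht => ?_⟩
    rw [hy t ht, intervalIntegral.integral_sub (hii (hgz g hg) t ht) (hii hH t ht), hgt g hg t ht,
      add_sub_assoc]

theorem YSet.snd_left {H : Ham d} {L s₀ y₀ : ℝ} {x₀ : Path d} {z : E d}
    {p : Path d × (ℝ → ℝ)} (hT : s₀ ≤ T) (h : p ∈ YSet T d H L s₀ x₀ y₀ z) : p.2 s₀ = y₀ := by
  simpa using (mem_YSet_iff.1 h).2.2.2 s₀ ⟨le_rfl, hT⟩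

theorem XSet.trans {L s₀ a : ℝ} (hL : 0 ≤ L) (hs₀ : 0 ≤ s₀) (ha : s₀ ≤ a)
    {x₀ x x' : Path d} (hx : x ∈ XSet T d L s₀ x₀) (hx' : x' ∈ XSet T d L a x) :
    x' ∈ XSet T d L s₀ x₀ := by
  rw [mem_XSet_iff hL hs₀] at hx ⊢
  rw [mem_XSet_iff hL (hs₀.trans ha)] at hx'
  obtain ⟨hc, he, hi⟩ := hx
  obtain ⟨hc', he', hi'⟩ := hx'
  refine ⟨hc', fun t ht => (he' t ⟨ht.1, ht.2.trans ha⟩).trans (he t ht), ?_⟩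
  have hleft : ∀ b c, s₀ ≤ b → b ≤ c → c ≤ a → c ≤ T →
      ‖x' c - x' b‖ ≤ L * (1 + runSup d x' c) * (c - b) := by
    intro b c hb hbc hca hcT
    have := hi b c hb hbc hcT
    rwa [he' b ⟨hs₀.trans hb, hbc.trans hca⟩, he' c ⟨hs₀.trans (hb.trans hbc), hca⟩,
      runSup_congr (x := x') (x' := x) fun s hs => he' s ⟨hs.1, hs.2.trans hca⟩]
  intro b c hb hbc hc
  rcases le_total c a with hca | hca
  · exact hleft b c hb hbc hca hc
  rcases le_total a b with hab | hab
  · exact hi' b c hab hbc hc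
  have h1 := hleft b a hb hab le_rfl (hca.trans hc)
  have h2 := hi' a c le_rfl hca hc
  have h3 := runSup_mono hc' (hs₀.trans ha) hca hc
  calc ‖x' c - x' b‖ ≤ ‖x' c - x' a‖ + ‖x' a - x' b‖ := norm_sub_le_norm_sub_add_norm_sub _ _ _
    _ ≤ L * (1 + runSup d x' c) * (c - a) + L * (1 + runSup d x' c) * (a - b) := by
        refine add_le_add h2 (h1.trans ?_)
        have : 0 ≤ a - b := sub_nonneg.2 hab
        gcongr
    _ = L * (1 + runSup d x' c) * (c - b) := by ring

/-- Characteristic pairs can be concatenated. -/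
theorem YSet.concat {H : Ham d} {M : ℝ → ℝ} (hH1 : HamCont T d H) (hH4 : HamLipX T d H M)
    {L s₀ a y₀ : ℝ} (hL : 0 ≤ L) (hs₀ : 0 ≤ s₀) (ha : s₀ ≤ a) (haT : a < T)
    {x₀ : Path d} (hx₀ : x₀ ∈ Cadlag T d) {z : E d} {p q : Path d × (ℝ → ℝ)}
    (hp : p ∈ YSet T d H L s₀ x₀ y₀ z) (hq : q ∈ YSet T d H L a p.1 (p.2 a) z) :
    (q.1, fun t => if t ≤ a then p.2 t else q.2 t) ∈ YSet T d H L s₀ x₀ y₀ z := by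
  have hqa := YSet.snd_left haT.le hq
  rw [mem_YSet_iff] at hp hq ⊢
  obtain ⟨hpX, hpc, hpi, hpy⟩ := hp
  obtain ⟨hqX, hqc, hqi, hqy⟩ := hq
  have hX := XSet.trans hL hs₀ ha hpX hqX
  set y : ℝ → ℝ := fun t => if t ≤ a then p.2 t else q.2 t with hy
  have hyl : ∀ t, t ≤ a → y t = p.2 t := fun t ht => if_pos ht
  have hyr : ∀ t, a ≤ t → y t = q.2 t := by
    intro t ht
    rcases ht.eq_or_lt with rfl | h
    · rw [hyl a le_rfl, hqa]
    · exact if_neg h.not_ge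
  have hu : Icc s₀ T = Icc s₀ a ∪ Icc a T := (Icc_union_Icc_eq_Icc ha haT.le).symm
  have hHl : (fun s => H s q.1 (y s) z) =ᵐ[volume.restrict (Ioc s₀ a)]
      fun s => H s p.1 (p.2 s) z := by
    rw [← restrict_Ioo_eq_restrict_Ioc]
    filter_upwards [ham_congr hH1 hH4 hL ⟨hs₀, ha.trans_lt haT⟩ haT.le hx₀ hX hpX
      (fun s hs => hqX.2.1 s hs) z, ae_restrict_mem measurableSet_Ioo] with s hs hsm
    rw [hyl s hsm.2.le, hs]
  have hHr : EqOn (fun s => H s q.1 (y s) z) (fun s => H s q.1 (q.2 s) z) (Icc a T) :=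
    fun s hs => by simp only [hyr s hs.1]
  have hil : IntegrableOn (fun s => H s q.1 (y s) z) (Icc s₀ a) volume := by
    rw [integrableOn_Icc_iff_integrableOn_Ioc]
    exact ((hpi.mono_set (Ioc_subset_Icc_self.trans (Icc_subset_Icc le_rfl haT.le)))).congr
      hHl.symm
  have hir : IntegrableOn (fun s => H s q.1 (y s) z) (Icc a T) volume :=
    (integrableOn_congr_fun hHr measurableSet_Icc).2 hqi
  have hIl : ∀ t, s₀ ≤ t → t ≤ a → ∫ s in s₀..t, H s q.1 (y s) z =
      ∫ s in s₀..t, H s p.1 (p.2 s) z := by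
    intro t h1 h2
    refine intervalIntegral.integral_congr_ae_restrict ?_
    rw [uIoc_of_le h1]
    exact ae_restrict_of_ae_restrict_of_subset (Ioc_subset_Ioc le_rfl h2) hHl
  refine ⟨hX, ?_, hu ▸ hil.union hir, fun t ht => ?_⟩
  · rw [hu]
    refine ContinuousOn.union_of_isClosed ?_ ?_ isClosed_Icc isClosed_Icc
    · exact (hpc.mono (Icc_subset_Icc le_rfl haT.le)).congr fun t ht => hyl t ht.2
    · exact hqc.congr fun t ht => hyr t ht.1
  · have hqs : q.1 s₀ = p.1 s₀ := hqX.2.1 s₀ ⟨hs₀, ha⟩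
    have hqe : q.1 a = p.1 a := hqX.2.1 a ⟨hs₀.trans ha, le_rfl⟩
    rcases le_total t a with hta | hta
    · simp only [hyl t hta]
      rw [hpy t ht, hIl t ht.1 hta, hqs, hqX.2.1 t ⟨hs₀.trans ht.1, hta⟩]
    · have hsplit : ∫ s in s₀..t, H s q.1 (y s) z =
          (∫ s in s₀..a, H s p.1 (p.2 s) z) + ∫ s in a..t, H s q.1 (q.2 s) z := by
        rw [← hIl a ha le_rfl, ← intervalIntegral.integral_add_adjacent_intervals (b := a)
          ((intervalIntegrable_iff_integrableOn_Icc_of_le ha).2 hil)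
          ((intervalIntegrable_iff_integrableOn_Icc_of_le hta).2
            (hir.mono_set (Icc_subset_Icc le_rfl ht.2)))]
        congr 1
        refine intervalIntegral.integral_congr fun s hs => ?_
        rw [uIcc_of_le hta] at hs
        exact hHr ⟨hs.1, hs.2.trans ht.2⟩
      simp only [hyr t hta]
      rw [hqy t ⟨hta, ht.2⟩, hpy a ⟨ha, haT.le⟩, hsplit, hqs, hqe, inner_sub_left, inner_sub_left,
        inner_sub_left]
      ring

/-- A lower semicontinuous function on `[0,T] × Ω` is non-anticipating. -/
theorem LscOn.congr {u : ℝ → Path d → ℝ} (hu : LscOn T d u) {t : ℝ} (ht : t ∈ Icc 0 T)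
    {x x' : Path d} (hx : x ∈ Cadlag T d) (hx' : x' ∈ Cadlag T d)
    (h : ∀ s ∈ Icc 0 t, x s = x' s) : u t x = u t x' := by
  have key : ∀ x ∈ Cadlag T d, ∀ x' ∈ Cadlag T d, (∀ s ∈ Icc 0 t, x s = x' s) →
      u t x ≤ u t x' := by
    intro x hx x' hx' h
    refine le_of_forall_lt fun c hc => ?_
    obtain ⟨δ, hδ, H⟩ := hu t ht x hx c hc
    refine H t ht x' hx' (lt_of_le_of_lt ?_ hδ)
    simp only [dInf, sub_self, abs_zero, zero_add, stopDist]
    refine Real.sSup_nonpos ?_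
    rintro _ ⟨r, hr, rfl⟩
    simp [h (min r t) ⟨le_min hr.1 ht.1, min_le_right _ _⟩]
  exact le_antisymm (key x hx x' hx' h) (key x' hx' x hx fun s hs => (h s hs).symm)

/-- Characteristic pairs dominating `u` at finitely many prescribed times. -/
theorem exists_mem_YSet_finset {H : Ham d} {M : ℝ → ℝ} (hH1 : HamCont T d H)
    (hH4 : HamLipX T d H M) {L : ℝ} (hL : 0 ≤ L) {u : ℝ → Path d → ℝ} (hu : LscOn T d u)
    {z : E d}
    (hex : ∀ s₀ ∈ Ico (0 : ℝ) T, ∀ x₀ ∈ Cadlag T d, ∀ (y₀ : ℝ), u s₀ x₀ ≤ y₀ →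
      ∀ t ∈ Ioc s₀ T, ∃ p ∈ YSet T d H L s₀ x₀ y₀ z, u t p.1 ≤ p.2 t) (S : Finset ℝ) :
    ∀ s₀ ∈ Ico (0 : ℝ) T, ∀ x₀ ∈ Cadlag T d, ∀ (y₀ : ℝ), u s₀ x₀ ≤ y₀ → ↑S ⊆ Ioc s₀ T →
      ∃ p ∈ YSet T d H L s₀ x₀ y₀ z, ∀ t ∈ S, u t p.1 ≤ p.2 t := by
  induction S using Finset.induction_on_min with
  | empty =>
    intro s₀ hs₀ x₀ hx₀ y₀ hy₀ _
    obtain ⟨p, hp, -⟩ := hex s₀ hs₀ x₀ hx₀ y₀ hy₀ T ⟨hs₀.2, le_rfl⟩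
    exact ⟨p, hp, by simp⟩
  | insert a S haS ih =>
    intro s₀ hs₀ x₀ hx₀ y₀ hy₀ hS
    have ha : a ∈ Ioc s₀ T := hS (by simp)
    have hST : ∀ t ∈ S, t ≤ T := fun t ht => (hS (by simp [ht])).2
    obtain ⟨p, hp, hpa⟩ := hex s₀ hs₀ x₀ hx₀ y₀ hy₀ a ha
    rcases ha.2.eq_or_lt with haT | haT
    · refine ⟨p, hp, fun t ht => ?_⟩
      rcases Finset.mem_insert.1 ht with rfl | ht
      · exact hpa
      · linarith [haS t ht, hST t ht]
    · obtain ⟨q, hq, hqS⟩ := ih a ⟨hs₀.1.trans ha.1.le, haT⟩ p.1 hp.1 (p.2 a) hpa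
        fun t ht => ⟨haS t ht, hST t ht⟩
      refine ⟨_, YSet.concat hH1 hH4 hL hs₀.1 ha.1.le haT hx₀ hp hq, fun t ht => ?_⟩
      rcases Finset.mem_insert.1 ht with rfl | ht
      · simp only [le_refl, if_true]
        rwa [hu.congr ⟨hs₀.1.trans ha.1.le, ha.2⟩ hq.1 hp.1 hq.2.1]
      · simpa only [if_neg (haS t ht).not_ge] using hqS t ht

/-- Characteristic pairs in `Y^L(s₀, x₀, y₀, z)` share common bounds. -/
theorem exists_bound_YSet {H : Ham d} {LH CH : ℝ} (hH3 : HamLipZ T d H LH)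
    (hH6 : HamBound T d H CH) {L s₀ : ℝ} (hL : 0 ≤ L) (hs₀ : s₀ ∈ Ico 0 T) (x₀ : Path d)
    (y₀ : ℝ) (z : E d) : ∃ R Y W : ℝ, 0 ≤ R ∧ 0 ≤ Y ∧ 0 ≤ W ∧ ∀ p ∈ YSet T d H L s₀ x₀ y₀ z,
      runSup d p.1 T ≤ R ∧ (∀ t ∈ Icc s₀ T, |p.2 t| ≤ Y) ∧
      ∀ᵐ s ∂(volume.restrict (Ioo s₀ T)), |H s p.1 (p.2 s) z| ≤ W := by
  obtain ⟨R, hR0, hR⟩ := exists_runSup_le (T := T) hL ⟨hs₀.1, hs₀.2.le⟩ x₀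
  obtain ⟨hLH, hlip⟩ := hH3
  obtain ⟨hCH, hbd⟩ := hH6
  set D := CH * (1 + R) + LH * (1 + R) * ‖z‖ with hD
  have hD0 : 0 ≤ D := by positivity
  have hTs : 0 ≤ T - s₀ := sub_nonneg.2 hs₀.2.le
  set A := |y₀| + 2 * R * ‖z‖ + D * (T - s₀) with hA
  have hA0 : 0 ≤ A := by positivity
  set Y := A * Real.exp (CH * (T - s₀)) with hY
  have hY0 : 0 ≤ Y := by positivity
  refine ⟨R, Y, CH * Y + D, hR0, hY0, by positivity, fun p hp => ?_⟩
  obtain ⟨hpX, hpc, hpi, hpy⟩ := mem_YSet_iff.1 hp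
  have hx := hpX.1
  have hHb : ∀ᵐ s ∂(volume.restrict (Ioo s₀ T)), |H s p.1 (p.2 s) z| ≤ CH * |p.2 s| + D := by
    filter_upwards [ae_restrict_Ioo_mono hs₀.1 le_rfl hlip, ae_restrict_Ioo_mono hs₀.1 le_rfl hbd,
      ae_restrict_mem measurableSet_Ioo] with s h1 h2 hs
    have hrs : runSup d p.1 s ≤ R :=
      (runSup_mono hx (hs₀.1.trans hs.1.le) hs.2.le le_rfl).trans (hR _ hpX)
    have h3 := h1 p.1 hx (p.2 s) z 0
    have h4 := h2 p.1 hx (p.2 s)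
    rw [sub_zero] at h3
    have h5 : LH * (1 + runSup d p.1 s) * ‖z‖ ≤ LH * (1 + R) * ‖z‖ := by gcongr
    have h6 : CH * (1 + runSup d p.1 s + |p.2 s|) ≤ CH * (1 + R + |p.2 s|) := by gcongr
    have h7 := abs_sub_abs_le_abs_sub (H s p.1 (p.2 s) z) (H s p.1 (p.2 s) 0)
    rw [hD]
    linarith
  have hyb : ∀ t ∈ Icc s₀ T, |p.2 t| ≤ Y := by
    have hg := le_mul_exp_of_le_add_integral (f := fun t => |p.2 t|) (A := A) hCH hpc.abs ?_
    · intro t ht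
      refine (hg t ht).trans ?_
      have := ht.2
      rw [hY]
      gcongr
    intro t ht
    have hci : IntervalIntegrable (fun s => CH * |p.2 s|) volume s₀ t :=
      ((continuousOn_const.mul hpc.abs).mono
        (Icc_subset_Icc le_rfl ht.2)).intervalIntegrable_of_Icc ht.1
    have hint : |∫ s in s₀..t, H s p.1 (p.2 s) z| ≤ ∫ s in s₀..t, (CH * |p.2 s| + D) := by
      rw [← Real.norm_eq_abs]
      refine intervalIntegral.norm_integral_le_of_norm_le ht.1 ?_
        (hci.add intervalIntegrable_const)
      rw [← ae_restrict_iff' measurableSet_Ioc]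
      exact ae_restrict_Ioc_of_Ioo le_rfl ht.2 hHb
    rw [intervalIntegral.integral_add hci intervalIntegrable_const,
      intervalIntegral.integral_const_mul, intervalIntegral.integral_const, smul_eq_mul] at hint
    have hin : |⟪p.1 t - p.1 s₀, z⟫_ℝ| ≤ 2 * R * ‖z‖ := by
      refine (abs_real_inner_le_norm _ _).trans (mul_le_mul_of_nonneg_right ?_ (norm_nonneg _))
      have h1 := norm_le_runSup hx ⟨hs₀.1.trans ht.1, ht.2⟩ le_rfl
      have h2 := norm_le_runSup hx ⟨hs₀.1, hs₀.2.le⟩ le_rfl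
      linarith [norm_sub_le (p.1 t) (p.1 s₀), hR _ hpX]
    have hDt : (t - s₀) * D ≤ D * (T - s₀) := by
      rw [mul_comm]
      gcongr
      exact ht.2
    rw [hpy t ht]
    have h1 := abs_sub (y₀ + ⟪p.1 t - p.1 s₀, z⟫_ℝ) (∫ s in s₀..t, H s p.1 (p.2 s) z)
    have h2 := abs_add_le y₀ ⟪p.1 t - p.1 s₀, z⟫_ℝ
    rw [hA]
    linarith
  refine ⟨hR _ hpX, hyb, ?_⟩
  filter_upwards [hHb, ae_restrict_mem measurableSet_Ioo] with s hs hsm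
  refine hs.trans ?_
  have := hyb s (Ioo_subset_Icc_self hsm)
  gcongr

/-- **Arzelà–Ascoli** for uniformly bounded, equi-Lipschitz functions on a compact interval. -/
theorem exists_tendstoUniformlyOn_of_lipschitzOnWith {V : Type*} [NormedAddCommGroup V]
    [ProperSpace V] {a b R : ℝ} (hab : a ≤ b) {K : NNReal} {f : ℕ → ℝ → V}
    (hf : ∀ n, LipschitzOnWith K (f n) (Icc a b)) (hR : ∀ n, ∀ t ∈ Icc a b, ‖f n t‖ ≤ R) :
    ∃ (g : ℝ → V) (φ : ℕ → ℕ), Continuous g ∧ StrictMono φ ∧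
      TendstoUniformlyOn (fun n => f (φ n)) g atTop (Icc a b) := by
  have hlip : ∀ n, LipschitzWith K (fun t : Icc a b => f n t) := fun n =>
    lipschitzOnWith_iff_restrict.1 (hf n)
  let F : ℕ → BoundedContinuousFunction (Icc a b) V := fun n =>
    BoundedContinuousFunction.mkOfCompact ⟨fun t => f n t, (hlip n).continuous⟩
  have hcomp : IsCompact (closure (range F)) := by
    refine BoundedContinuousFunction.arzela_ascoli (Metric.closedBall 0 R)
      (isCompact_closedBall 0 R) _ ?_ ?_
    · rintro _ t ⟨n, rfl⟩
      exact mem_closedBall_zero_iff.2 (hR n t t.2)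
    · refine (LipschitzWith.uniformEquicontinuous _ K ?_).equicontinuous
      rintro ⟨_, n, rfl⟩
      exact hlip n
  obtain ⟨G, -, φ, hφ, hG⟩ := hcomp.tendsto_subseq fun n => subset_closure (mem_range_self n)
  refine ⟨fun t => G (projIcc a b hab t), φ, G.continuous.comp continuous_projIcc, hφ, ?_⟩
  rw [BoundedContinuousFunction.tendsto_iff_tendstoUniformly] at hG
  rw [Metric.tendstoUniformlyOn_iff]
  intro ε hε
  filter_upwards [Metric.tendstoUniformly_iff.1 hG ε hε] with n hn t ht
  rw [projIcc_of_mem hab ht]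
  exact hn ⟨t, ht⟩

theorem Cadlag.piecewise {s₀ : ℝ} {x₀ g : Path d} (hx₀ : x₀ ∈ Cadlag T d)
    (hg : Continuous g) : (fun t => if t < s₀ then x₀ t else g t) ∈ Cadlag T d := by
  refine ⟨fun t ht => ?_, fun t ht => ?_⟩
  · rcases lt_or_ge t s₀ with h | h
    · refine (hx₀.1 t ht).congr_of_eventuallyEq ?_ (if_pos h)
      filter_upwards [mem_nhdsWithin_of_mem_nhds (Iio_mem_nhds h)] with s hs using if_pos hs
    · exact hg.continuousWithinAt.congr (fun s hs => if_neg (h.trans hs).not_gt) (if_neg h.not_gt)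
  · rcases le_or_gt t s₀ with h | h
    · obtain ⟨l, hl⟩ := hx₀.2 t ht
      refine ⟨l, hl.congr' ?_⟩
      filter_upwards [self_mem_nhdsWithin] with s hs
      exact (if_pos (lt_of_lt_of_le hs h)).symm
    · refine ⟨g t, (hg.continuousAt.tendsto.mono_left nhdsWithin_le_nhds).congr' ?_⟩
      filter_upwards [mem_nhdsWithin_of_mem_nhds (Ioi_mem_nhds h)] with s hs
      exact (if_neg (not_lt.2 (le_of_lt hs))).symm

/-- Increment bounds pass to uniform limits. -/
theorem IncBound.of_tendsto {L s₀ : ℝ} (hL : 0 ≤ L) (hs₀ : 0 ≤ s₀) {x : ℕ → Path d} {x' : Path d}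
    (hx : ∀ n, IncBound T d L s₀ (x n)) (hx' : x' ∈ Cadlag T d)
    (h : ∀ ε > (0 : ℝ), ∀ᶠ n in atTop, ∀ s ∈ Icc 0 T, ‖x n s - x' s‖ < ε) :
    IncBound T d L s₀ x' := by
  intro a b ha hab hb
  have hpt : ∀ s ∈ Icc 0 T, Tendsto (fun n => x n s) atTop (𝓝 (x' s)) := fun s hs =>
    Metric.tendsto_nhds.2 fun ε hε => (h ε hε).mono fun n hn => by
      rw [dist_eq_norm]; exact hn s hs
  have hlim : Tendsto (fun ε : ℝ => L * (1 + (runSup d x' b + ε)) * (b - a)) (𝓝[>] 0)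
      (𝓝 (L * (1 + (runSup d x' b + 0)) * (b - a))) :=
    (Continuous.tendsto (by fun_prop) 0).mono_left nhdsWithin_le_nhds
  rw [add_zero] at hlim
  refine ge_of_tendsto hlim ?_
  filter_upwards [self_mem_nhdsWithin] with ε hε
  refine le_of_tendsto (((hpt b ⟨hs₀.trans (ha.trans hab), hb⟩).sub
    (hpt a ⟨hs₀.trans ha, hab.trans hb⟩)).norm) ?_
  filter_upwards [h ε hε] with n hn
  refine (hx n a b ha hab hb).trans ?_
  have hr : runSup d (x n) b ≤ runSup d x' b + ε := by
    refine runSup_le (hs₀.trans (ha.trans hab)) fun s hs => ?_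
    have h1 := hn s ⟨hs.1, hs.2.trans hb⟩
    have h2 := norm_le_runSup hx' hs hb
    have h3 := norm_sub_norm_le (x n s) (x' s)
    linarith
  have := sub_nonneg.2 hab
  gcongr

/-- Sequential compactness of `Y^L(s₀, x₀, y₀, z)` with respect to uniform convergence. -/
theorem exists_subseq_YSet {H : Ham d} {LH CH : ℝ} (hH1 : HamCont T d H)
    (hH3 : HamLipZ T d H LH) (hH6 : HamBound T d H CH) {L s₀ : ℝ} (hL : 0 ≤ L)
    (hs₀ : s₀ ∈ Ico 0 T) {x₀ : Path d} (hx₀ : x₀ ∈ Cadlag T d) {y₀ : ℝ} {z : E d}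
    {p : ℕ → Path d × (ℝ → ℝ)} (hp : ∀ n, p n ∈ YSet T d H L s₀ x₀ y₀ z) :
    ∃ q ∈ YSet T d H L s₀ x₀ y₀ z, ∃ φ : ℕ → ℕ, StrictMono φ ∧ ∀ ε > (0 : ℝ),
      ∀ᶠ n in atTop, (∀ s ∈ Icc 0 T, ‖(p (φ n)).1 s - q.1 s‖ < ε) ∧
        ∀ s ∈ Icc s₀ T, |(p (φ n)).2 s - q.2 s| < ε := by
  obtain ⟨R, Y, W, hR0, hY0, hW0, hb⟩ := exists_bound_YSet hH3 hH6 hL hs₀ x₀ y₀ z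
  have hT := hs₀.2.le
  have hX : ∀ n, (p n).1 ∈ XSet T d L s₀ x₀ := fun n => (mem_YSet_iff.1 (hp n)).1
  have hinc : ∀ n, IncBound T d L s₀ (p n).1 := fun n =>
    ((mem_XSet_iff hL hs₀.1).1 (hX n)).2.2
  have hHint : ∀ n, ∀ a b, s₀ ≤ a → a ≤ b → b ≤ T →
      IntervalIntegrable (fun s => H s (p n).1 ((p n).2 s) z) volume a b := fun n a b ha hab hb =>
    (intervalIntegrable_iff_integrableOn_Icc_of_le hab).2
      ((mem_YSet_iff.1 (hp n)).2.2.1.mono_set (Icc_subset_Icc ha hb))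
  have hxinc : ∀ n, ∀ a ∈ Icc s₀ T, ∀ b ∈ Icc s₀ T, a ≤ b →
      ‖(p n).1 b - (p n).1 a‖ ≤ L * (1 + R) * (b - a) := by
    intro n a ha b hb' hab
    refine (hinc n a b ha.1 hab hb'.2).trans ?_
    have h1 := (runSup_mono (hX n).1 (hs₀.1.trans hb'.1) hb'.2 le_rfl).trans (hb _ (hp n)).1
    have := sub_nonneg.2 hab
    gcongr
  set K := L * (1 + R) + (L * (1 + R) * ‖z‖ + W) with hK
  have hlip : ∀ n, LipschitzOnWith K.toNNReal (fun t => ((p n).1 t, (p n).2 t)) (Icc s₀ T) := by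
    refine fun n => lipschitzOnWith_of_le (by positivity) fun a ha b hb' hab => ?_
    have hab' := sub_nonneg.2 hab
    rw [Prod.mk_sub_mk, Prod.norm_mk]
    refine max_le ((hxinc n a ha b hb' hab).trans ?_) ?_
    · rw [hK, add_mul]
      exact le_add_of_nonneg_right (by positivity)
    · obtain ⟨-, -, -, hy⟩ := mem_YSet_iff.1 (hp n)
      have hdiff : (p n).2 b - (p n).2 a = ⟪(p n).1 b - (p n).1 a, z⟫_ℝ -
          ∫ s in a..b, H s (p n).1 ((p n).2 s) z := by
        rw [hy b hb', hy a ha, ← intervalIntegral.integral_add_adjacent_intervals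
          (hHint n s₀ a le_rfl ha.1 ha.2) (hHint n a b ha.1 hab hb'.2), inner_sub_left,
          inner_sub_left, inner_sub_left]
        ring
      have h1 : ‖⟪(p n).1 b - (p n).1 a, z⟫_ℝ‖ ≤ L * (1 + R) * (b - a) * ‖z‖ :=
        (norm_inner_le_norm _ _).trans
          (mul_le_mul_of_nonneg_right (hxinc n a ha b hb' hab) (norm_nonneg _))
      have h2 : ‖∫ s in a..b, H s (p n).1 ((p n).2 s) z‖ ≤ W * |b - a| := by
        refine intervalIntegral.norm_integral_le_of_norm_le_const_ae ?_
        rw [uIoc_of_le hab, ← ae_restrict_iff' measurableSet_Ioc]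
        exact ae_restrict_Ioc_of_Ioo ha.1 hb'.2 (hb _ (hp n)).2.2
      rw [abs_of_nonneg hab'] at h2
      rw [hdiff]
      refine (norm_sub_le _ _).trans ((add_le_add h1 h2).trans ?_)
      have : 0 ≤ L * (1 + R) * (b - a) := by positivity
      rw [hK]
      linarith
  obtain ⟨f, φ, hfc, hφ, hf⟩ := exists_tendstoUniformlyOn_of_lipschitzOnWith (R := max R Y) hT
    hlip fun n t ht => by
      rw [Prod.norm_mk]
      exact max_le_max ((norm_le_runSup (hX n).1 ⟨hs₀.1.trans ht.1, ht.2⟩ le_rfl).trans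
        (hb _ (hp n)).1) ((hb _ (hp n)).2.1 t ht)
  set x : Path d := fun t => if t < s₀ then x₀ t else (f t).1 with hxdef
  set y : ℝ → ℝ := fun t => (f t).2 with hydef
  have hxr : ∀ t, s₀ ≤ t → x t = (f t).1 := fun t ht => if_neg ht.not_gt
  have hunif : ∀ ε > (0 : ℝ), ∀ᶠ n in atTop, (∀ s ∈ Icc 0 T, ‖(p (φ n)).1 s - x s‖ < ε) ∧
      ∀ s ∈ Icc s₀ T, |(p (φ n)).2 s - y s| < ε := by
    intro ε hε
    filter_upwards [Metric.tendstoUniformlyOn_iff.1 hf ε hε] with n hn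
    have hn' : ∀ t ∈ Icc s₀ T, ‖(p (φ n)).1 t - (f t).1‖ < ε ∧ |(p (φ n)).2 t - (f t).2| < ε := by
      intro t ht
      have := hn t ht
      rw [dist_comm, dist_eq_norm, Prod.norm_def, max_lt_iff] at this
      exact this
    refine ⟨fun s hs => ?_, fun s hs => (hn' s hs).2⟩
    rcases lt_or_ge s s₀ with h | h
    · have : x s = x₀ s := if_pos h
      rw [this, (hX (φ n)).2.1 s ⟨hs.1, h.le⟩]
      simpa using hε
    · rw [hxr s h]
      exact (hn' s ⟨h, hs.2⟩).1
  have hxpt : ∀ s ∈ Icc 0 T, Tendsto (fun n => (p (φ n)).1 s) atTop (𝓝 (x s)) := fun s hs =>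
    Metric.tendsto_nhds.2 fun ε hε => (hunif ε hε).mono fun n hn => by
      rw [dist_eq_norm]; exact hn.1 s hs
  have hypt : ∀ s ∈ Icc s₀ T, Tendsto (fun n => (p (φ n)).2 s) atTop (𝓝 (y s)) := fun s hs =>
    Metric.tendsto_nhds.2 fun ε hε => (hunif ε hε).mono fun n hn => by
      rw [Real.dist_eq]; exact hn.2 s hs
  have hxC : x ∈ Cadlag T d := Cadlag.piecewise hx₀ hfc.fst
  have hxX : x ∈ XSet T d L s₀ x₀ := by
    refine (mem_XSet_iff hL hs₀.1).2 ⟨hxC, fun t ht => ?_, ?_⟩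
    · refine tendsto_nhds_unique (hxpt t ⟨ht.1, ht.2.trans hT⟩) ?_
      simp_rw [fun n => (hX (φ n)).2.1 t ht]
      exact tendsto_const_nhds
    · exact IncBound.of_tendsto hL hs₀.1 (fun n => hinc (φ n)) hxC
        fun ε hε => (hunif ε hε).mono fun n hn => hn.1
  have hHlim : ∀ᵐ s ∂(volume.restrict (Ioo s₀ T)),
      Tendsto (fun n => H s (p (φ n)).1 ((p (φ n)).2 s) z) atTop (𝓝 (H s x (y s) z)) := by
    filter_upwards [ae_restrict_Ioo_mono hs₀.1 le_rfl hH1, ae_restrict_mem measurableSet_Ioo]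
      with s hs hsm
    refine Metric.tendsto_nhds.2 fun ε hε => ?_
    obtain ⟨δ, hδ, h⟩ := hs x hxC (y s) z ε hε
    filter_upwards [hunif (δ / 2) (half_pos hδ)] with n hn
    rw [dist_comm, Real.dist_eq]
    refine h _ (hX (φ n)).1 _ z ((supDist_le (half_pos hδ).le fun r hr => ?_).trans_lt
      (half_lt_self hδ)) ?_ (by simpa)
    · rw [norm_sub_rev]; exact (hn.1 r hr).le
    · rw [abs_sub_comm]
      exact (hn.2 s (Ioo_subset_Icc_self hsm)).trans (half_lt_self hδ)
  have hHb : ∀ᵐ s ∂(volume.restrict (Ioo s₀ T)), ∀ n, |H s (p n).1 ((p n).2 s) z| ≤ W :=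
    ae_all_iff.2 fun n => (hb _ (hp n)).2.2
  have hHi : IntegrableOn (fun s => H s x (y s) z) (Icc s₀ T) volume := by
    rw [integrableOn_Icc_iff_integrableOn_Ioo]
    refine Integrable.of_bound (C := W) ?_ ?_
    · exact aestronglyMeasurable_of_tendsto_ae atTop (fun n =>
        ((mem_YSet_iff.1 (hp (φ n))).2.2.1.mono_set Ioo_subset_Icc_self).aestronglyMeasurable) hHlim
    · filter_upwards [hHlim, hHb] with s hs hsb
      exact le_of_tendsto hs.norm (Eventually.of_forall fun n => hsb (φ n))
  refine ⟨(x, y), mem_YSet_iff.2 ⟨hxX, hfc.snd.continuousOn, hHi, fun t ht => ?_⟩, φ, hφ, hunif⟩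
  have hIlim : Tendsto (fun n => ∫ s in s₀..t, H s (p (φ n)).1 ((p (φ n)).2 s) z) atTop
      (𝓝 (∫ s in s₀..t, H s x (y s) z)) := by
    refine intervalIntegral.tendsto_integral_filter_of_dominated_convergence (fun _ => W)
      (Eventually.of_forall fun n => ?_) (Eventually.of_forall fun n => ?_)
      intervalIntegrable_const ?_
    · rw [uIoc_of_le ht.1]
      exact (hHint (φ n) s₀ t le_rfl ht.1 ht.2).1.aestronglyMeasurable
    · rw [uIoc_of_le ht.1, ← ae_restrict_iff' measurableSet_Ioc]
      filter_upwards [ae_restrict_Ioc_of_Ioo le_rfl ht.2 hHb] with s hs using hs (φ n)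
    · rw [uIoc_of_le ht.1, ← ae_restrict_iff' measurableSet_Ioc]
      exact ae_restrict_Ioc_of_Ioo le_rfl ht.2 hHlim
  refine tendsto_nhds_unique (hypt t ht) ?_
  simp_rw [fun n => (mem_YSet_iff.1 (hp (φ n))).2.2.2 t ht]
  exact (tendsto_const_nhds.add (((hxpt t ⟨hs₀.1.trans ht.1, ht.2⟩).sub
    (hxpt s₀ ⟨hs₀.1, hT⟩)).inner tendsto_const_nhds)).sub hIlim

theorem dInf_le {K : NNReal} {s₀ t r ε : ℝ} {x x' : Path d}
    (hx : LipschitzOnWith K x (Icc s₀ T)) (ht : t ∈ Icc s₀ T) (hr : r ∈ Icc s₀ T) (hr0 : 0 ≤ r)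
    (hε : 0 ≤ ε) (h : ∀ s ∈ Icc 0 T, ‖x s - x' s‖ ≤ ε) :
    dInf T d (t, x) (r, x') ≤ |t - r| + (K * |t - r| + ε) := by
  refine add_le_add_right (Real.sSup_le ?_ (by positivity)) _
  rintro _ ⟨s, hs, rfl⟩
  refine (norm_sub_le_norm_sub_add_norm_sub _ (x (min s r)) _).trans (add_le_add ?_ ?_)
  · rcases le_total s s₀ with hss | hss
    · rw [min_eq_left (hss.trans ht.1), min_eq_left (hss.trans hr.1), sub_self, norm_zero]
      positivity
    · have h1 := hx.dist_le_mul (min s t) ⟨le_min hss ht.1, (min_le_right _ _).trans ht.2⟩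
        (min s r) ⟨le_min hss hr.1, (min_le_right _ _).trans hr.2⟩
      rw [dist_eq_norm, Real.dist_eq] at h1
      refine h1.trans (mul_le_mul_of_nonneg_left ?_ K.2)
      simpa using abs_min_sub_min_le_max s t s r
  · exact h _ ⟨le_min hs.1 hr0, (min_le_left _ _).trans hs.2⟩

end Auxiliary

/-- Equivalent criterion for being a minimax `L`-supersolution: the
universally quantified terminal time `t ∈ (s₀,T]` may be moved in front of the
existential quantifier over characteristic pairs. -/
theorem minimaxSuper_iff (T : ℝ) (hT : 0 < T) (d : ℕ) (hd : 1 ≤ d)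
    (H : Ham d) (LH CH : ℝ) (M : ℝ → ℝ)
    (hH1 : HamCont T d H) (hH2 : HamMeas d H) (hH3 : HamLipZ T d H LH)
    (hH4 : HamLipX T d H M) (hH5 : HamMono T d H) (hH6 : HamBound T d H CH)
    (h : Path d → ℝ) (hh : TermCont T d h)
    (L : ℝ) (hL : 0 ≤ L) (u : ℝ → Path d → ℝ) :
    MinimaxSuper T d H h L u ↔
      (LscOn T d u ∧ (∀ x ∈ Cadlag T d, h x ≤ u T x) ∧
       ∀ s₀ ∈ Ico (0 : ℝ) T, ∀ x₀ ∈ Cadlag T d, ∀ (z : E d) (y₀ : ℝ), u s₀ x₀ ≤ y₀ →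
         ∀ t ∈ Ioc s₀ T, ∃ p ∈ YSet T d H L s₀ x₀ y₀ z, u t p.1 ≤ p.2 t) := by
  constructor
  · rintro ⟨hu, hT', hex⟩
    refine ⟨hu, hT', fun s₀ hs₀ x₀ hx₀ z y₀ hy₀ t ht => ?_⟩
    obtain ⟨p, hp, hpu⟩ := hex s₀ hs₀ x₀ hx₀ z y₀ hy₀
    exact ⟨p, hp, hpu t (Ioc_subset_Icc_self ht)⟩
  rintro ⟨hu, hT', hex⟩
  refine ⟨hu, hT', fun s₀ hs₀ x₀ hx₀ z y₀ hy₀ => ?_⟩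
  have : Nonempty (Ioc s₀ T) := ⟨⟨T, hs₀.2, le_rfl⟩⟩
  set r : ℕ → Ioc s₀ T := TopologicalSpace.denseSeq (Ioc s₀ T)
  have hr : DenseRange r := TopologicalSpace.denseRange_denseSeq _
  have hfin : ∀ n : ℕ, ∃ p ∈ YSet T d H L s₀ x₀ y₀ z, ∀ k < n, u (r k) p.1 ≤ p.2 (r k) := by
    intro n
    obtain ⟨p, hp, hpu⟩ := exists_mem_YSet_finset hH1 hH4 hL hu
      (fun s hs x hx y hy => hex s hs x hx z y hy)
      ((Finset.range n).image fun k => (r k : ℝ)) s₀ hs₀ x₀ hx₀ y₀ hy₀ (by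
        intro t ht
        obtain ⟨k, -, rfl⟩ := Finset.mem_image.1 (Finset.mem_coe.1 ht)
        exact (r k).2)
    exact ⟨p, hp, fun k hk => hpu _ (Finset.mem_image_of_mem _ (Finset.mem_range.2 hk))⟩
  choose p hp hpu using hfin
  obtain ⟨q, hq, φ, hφ, hlim⟩ := exists_subseq_YSet hH1 hH3 hH6 hL hs₀ hx₀ hp
  refine ⟨q, hq, fun t ht => ?_⟩
  rcases ht.1.eq_or_lt with rfl | hst
  · rw [hu.congr ⟨hs₀.1, hs₀.2.le⟩ hq.1 hx₀ hq.2.1, YSet.snd_left hs₀.2.le hq]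
    exact hy₀
  by_contra! hlt
  obtain ⟨c, hyc, hcu⟩ := exists_between hlt
  obtain ⟨c', hyc', hcc'⟩ := exists_between hyc
  obtain ⟨δ, hδ, hδu⟩ := hu t ⟨hs₀.1.trans ht.1, ht.2⟩ q.1 hq.1 c hcu
  have hK := ((mem_XSet_iff hL hs₀.1).1 (mem_YSet_iff.1 hq).1).2.2.lipschitzOnWith hL hs₀.1 hq.1
  set K := Real.toNNReal (L * (1 + runSup d q.1 T))
  let t' : Ioc s₀ T := ⟨t, hst, ht.2⟩
  obtain ⟨k, hkc, hkδ⟩ : ∃ k, q.2 (r k) < c' ∧ |t - r k| + K * |t - r k| < δ / 2 := by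
    have h1 : ∀ᶠ s : Ioc s₀ T in 𝓝 t', q.2 s < c' := by
      have hc : Continuous fun s : Ioc s₀ T => q.2 s :=
        continuousOn_iff_continuous_domRestrict.1
          ((mem_YSet_iff.1 hq).2.1.mono Ioc_subset_Icc_self)
      exact hc.tendsto t' (Iio_mem_nhds hyc')
    have h2 : ∀ᶠ s : Ioc s₀ T in 𝓝 t', |t - s| + K * |t - s| < δ / 2 := by
      have hc : Continuous fun s : Ioc s₀ T => |t - s| + K * |t - s| := by fun_prop
      exact hc.tendsto t' (Iio_mem_nhds (by simpa [t'] using hδ))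
    obtain ⟨_, hs, k, rfl⟩ := mem_closure_iff_nhds.1 (hr t') _ (h1.and h2)
    exact ⟨k, hs⟩
  have hkm := Ioc_subset_Icc_self (r k).2
  obtain ⟨n, ⟨hn1, hn2⟩, hn3⟩ := ((hlim (min (δ / 2) (c - c'))
    (lt_min (half_pos hδ) (sub_pos.2 hcc'))).and (eventually_gt_atTop k)).exists
  have hdist := dInf_le (x' := (p (φ n)).1) hK ht hkm (hs₀.1.trans hkm.1) (half_pos hδ).le
    fun s hs => by
      rw [norm_sub_rev]
      exact (hn1 s hs).le.trans (min_le_left _ _)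
  have h1 := hδu (r k) ⟨hs₀.1.trans hkm.1, hkm.2⟩ _ (hp (φ n)).1 (by linarith)
  have h2 := hpu (φ n) k (hn3.trans_le (hφ.id_le n))
  have h3 := (abs_lt.1 ((hn2 (r k) hkm).trans_le (min_le_right _ _))).2
  linarith

end PHJ
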